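/- Let p_{n,3} = ∑_{k=0}^n C(n,k)⁴·k!·(r_1(k)³ + 3·r_1(k)·r_2(k) + r_3(k)). Then for every integer n ≥ 2: (n+2)²(729n⁴−162n³−171n²−4n+6)·p_{n+2,3} = (2916n⁷+14661n⁶+20862n⁵+947n⁴−13008n³−2370n²+1320n+312)·p_{n+1,3} − (4374n⁸−18468n⁷−82674n⁶−85776n⁵−13062n⁴+24204n³+13528n²+2680n+168)·p_{n,3} + n²(2916n⁷+28512n⁶+61848n⁵+37667n⁴−12898n³−17463n²−2692n+398)·p_{n−1,3} − n²(n−1)⁴(729n⁴+2754n³+3717n²+2084n+398)·p_{n−2,3} − 6(729n^{10}+2754n⁹−17424n⁸−179680n⁷−490669n⁶−549106n⁵−194460n⁴+100424n³+105332n²+30840n+3184)/(n(n+1)²(n+2)). -/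

import Mathlib

/-- Generalized harmonic number `H_n^{(m)} = ∑_{j=1}^n 1/j^m`. -/
noncomputable def genHarmonic (m n : ℕ) : ℚ :=
  ∑ j ∈ Finset.range n, (1 : ℚ) / ((j : ℚ) + 1) ^ m

/-- `r_1(k) = 4·H_{n-k} - 3·H_k`. -/
noncomputable def r1 (n k : ℕ) : ℚ := 4 * harmonic (n - k) - 3 * harmonic k

/-- `r_2(k) = 4·H_{n-k}^{(2)} + 3·H_k^{(2)}`. -/
noncomputable def r2 (n k : ℕ) : ℚ := 4 * genHarmonic 2 (n - k) + 3 * genHarmonic 2 k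

/-- `r_3(k) = 2·(4·H_{n-k}^{(3)} - 3·H_k^{(3)})`. -/
noncomputable def r3 (n k : ℕ) : ℚ := 2 * (4 * genHarmonic 3 (n - k) - 3 * genHarmonic 3 k)

/-- `p_{n,3} = ∑_{k=0}^n C(n,k)⁴ · k! · (r_1(k)³ + 3·r_1(k)·r_2(k) + r_3(k))`. -/
noncomputable def pseq43 (n : ℕ) : ℚ :=
  ∑ k ∈ Finset.range (n + 1), (n.choose k : ℚ) ^ 4 * (Nat.factorial k : ℚ) *
    ((r1 n k) ^ 3 + 3 * r1 n k * r2 n k + r3 n k)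

section Certificate

variable {R : Type*} [CommRing R]

/-- The numerator of the Zeilberger certificate for `∑ k, C(n,k)⁴ k!`. -/
def certNum (n x : R) : R :=
    (729 * n ^ 4 + 2754 * n ^ 3 + 3717 * n ^ 2 + 2084 * n + 398) * x ^ 12 +
    (-8748 * n ^ 5 - 41067 * n ^ 4 - 74898 * n ^ 3 - 65895 * n ^ 2 - 27700 * n - 4378) * x ^ 11
    +
    (48114 * n ^ 6 + 272160 * n ^ 5 + 621810 * n ^ 4 + 730644 * n ^ 3 + 463100 * n ^ 2 + 149384
    * n + 19104) * x ^ 10 +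
    (-160380 * n ^ 7 - 1066608 * n ^ 6 - 2934432 * n ^ 5 - 4297943 * n ^ 4 - 3584250 * n ^ 3 -
    1679995 * n ^ 2 - 403348 * n - 37810) * x ^ 9 +
    (360855 * n ^ 8 + 2762910 * n ^ 7 + 8903439 * n ^ 6 + 15648408 * n ^ 5 + 16176777 * n ^ 4 +
    9823854 * n ^ 3 + 3258741 * n ^ 2 + 475948 * n + 11542) * x ^ 8 +
    (-577368 * n ^ 9 - 4993650 * n ^ 8 - 18394776 * n ^ 7 - 37673118 * n ^ 6 - 46608852 * n ^ 5
    - 35024911 * n ^ 4 - 14847898 * n ^ 3 - 2622893 * n ^ 2 + 218172 * n + 103082) * x ^ 7 +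
    (673596 * n ^ 10 + 6463800 * n ^ 9 + 26549883 * n ^ 8 + 61394574 * n ^ 7 + 87752133 * n ^ 6
    + 78892504 * n ^ 5 + 41926486 * n ^ 4 + 9654004 * n ^ 3 - 1728778 * n ^ 2 - 1460488 * n -
    228452) * x ^ 6 +
    (-577368 * n ^ 11 - 6039036 * n ^ 10 - 26904636 * n ^ 9 - 67358781 * n ^ 8 - 105151446 * n ^
    7 - 106274745 * n ^ 6 - 67478244 * n ^ 5 - 21393557 * n ^ 4 + 2788702 * n ^ 3 + 5399415 * n
    ^ 2 + 1874236 * n + 219298) * x ^ 5 +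
    (360855 * n ^ 12 + 4040118 * n ^ 11 + 18888309 * n ^ 10 + 47906280 * n ^ 9 + 71848080 * n ^
    8 + 65286296 * n ^ 7 + 35302220 * n ^ 6 + 9505576 * n ^ 5 - 2318566 * n ^ 4 - 4959656 * n ^
    3 - 3086228 * n ^ 2 - 867248 * n - 85968) * x ^ 4 +
    (-160380 * n ^ 13 - 1885275 * n ^ 12 - 8864442 * n ^ 11 - 19926587 * n ^ 10 - 15648308 * n ^
    9 + 23156707 * n ^ 8 + 68094582 * n ^ 7 + 66950883 * n ^ 6 + 26361684 * n ^ 5 - 3117114 * n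
    ^ 4 - 6483688 * n ^ 3 - 2145392 * n ^ 2 - 283952 * n - 15920) * x ^ 3 +
    (48114 * n ^ 14 + 581256 * n ^ 13 + 2587761 * n ^ 12 + 3320610 * n ^ 11 - 13400747 * n ^ 10
    - 67308308 * n ^ 9 - 135978054 * n ^ 8 - 150206600 * n ^ 7 - 85920086 * n ^ 6 - 9028248 * n
    ^ 5 + 20117348 * n ^ 4 + 13372544 * n ^ 3 + 3747360 * n ^ 2 + 496352 * n + 25472) * x ^ 2 +
    (-8748 * n ^ 15 - 105948 * n ^ 14 - 404568 * n ^ 13 + 541515 * n ^ 12 + 10407958 * n ^ 11 +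
    42448875 * n ^ 10 + 93963320 * n ^ 9 + 126102352 * n ^ 8 + 99898180 * n ^ 7 + 35372316 * n ^
    6 - 10569484 * n ^ 5 - 17634244 * n ^ 4 - 8248392 * n ^ 3 - 1879144 * n ^ 2 - 198912 * n -
    6368) * x +
    (729 * n ^ 16 + 8586 * n ^ 15 + 22833 * n ^ 14 - 222520 * n ^ 13 - 2238645 * n ^ 12 -
    9545626 * n ^ 11 - 24147713 * n ^ 10 - 38998760 * n ^ 9 - 39994976 * n ^ 8 - 23305704 * n ^
    7 - 3138412 * n ^ 6 + 6055280 * n ^ 5 + 5004208 * n ^ 4 + 1827168 * n ^ 3 + 335872 * n ^ 2 +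
    25472 * n)

theorem map_certNum {S : Type*} [CommRing S] (φ : R →+* S) (n x : R) :
    φ (certNum n x) = certNum (φ n) (φ x) := by
  simp only [certNum, map_add, map_sub, map_mul, map_pow, map_neg, map_ofNat]

theorem certNum_gosper (n x : R) :
    n ^ 2 * (n + 1) ^ 4 * (n + 2) ^ 4 * ((n + 2) ^ 2 *
        (729 * n ^ 4 - 162 * n ^ 3 - 171 * n ^ 2 - 4 * n + 6)) -
      n ^ 2 * (n + 1) ^ 4 * (2916 * n ^ 7 + 14661 * n ^ 6 + 20862 * n ^ 5 + 947 * n ^ 4 -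
        13008 * n ^ 3 - 2370 * n ^ 2 + 1320 * n + 312) * (n + 2 - x) ^ 4 +
      n ^ 2 * (4374 * n ^ 8 - 18468 * n ^ 7 - 82674 * n ^ 6 - 85776 * n ^ 5 -
        13062 * n ^ 4 + 24204 * n ^ 3 + 13528 * n ^ 2 + 2680 * n + 168) *
        ((n + 2 - x) ^ 4 * (n + 1 - x) ^ 4) -
      (2916 * n ^ 7 + 28512 * n ^ 6 + 61848 * n ^ 5 + 37667 * n ^ 4 - 12898 * n ^ 3 -
        17463 * n ^ 2 - 2692 * n + 398) * ((n + 2 - x) ^ 4 * (n + 1 - x) ^ 4 * (n - x) ^ 4) +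
      (729 * n ^ 4 + 2754 * n ^ 3 + 3717 * n ^ 2 + 2084 * n + 398) *
        ((n + 2 - x) ^ 4 * (n + 1 - x) ^ 4 * (n - x) ^ 4 * (n - 1 - x) ^ 4) =
      (n + 2 - x) ^ 4 * certNum n (x + 1) - x ^ 3 * certNum n x := by
  unfold certNum
  ring

end Certificate

open PowerSeries in
/-- `f = c * exp (p X + q X² / 2 + r X³ / 6)` up to terms of order four. -/
structure IsExpJet (f : ℚ⟦X⟧) (c p q r : ℚ) : Prop where
  coeff_zero : coeff 0 f = c
  coeff_one : coeff 1 f = c * p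
  coeff_two : coeff 2 f = c * ((p ^ 2 + q) / 2)
  coeff_three : coeff 3 f = c * ((p ^ 3 + 3 * p * q + r) / 6)

namespace IsExpJet

open PowerSeries

variable {f g : ℚ⟦X⟧} {c p q r c' p' q' r' : ℚ}

theorem one : IsExpJet 1 1 0 0 0 := by
  constructor <;> simp

theorem mul (hf : IsExpJet f c p q r) (hg : IsExpJet g c' p' q' r') :
    IsExpJet (f * g) (c * c') (p + p') (q + q') (r + r') := by
  obtain ⟨f0, f1, f2, f3⟩ := hf
  obtain ⟨g0, g1, g2, g3⟩ := hg
  constructor <;>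
    simp only [coeff_mul, Finset.Nat.sum_antidiagonal_eq_sum_range_succ_mk, Finset.sum_range_succ,
      Finset.sum_range_zero, Nat.sub_zero, Nat.sub_self, Nat.reduceSub, f0, f1, f2, f3, g0, g1, g2,
      g3] <;>
    ring

theorem pow (hf : IsExpJet f c p q r) (k : ℕ) :
    IsExpJet (f ^ k) (c ^ k) (k * p) (k * q) (k * r) := by
  induction k with
  | zero => simpa using one
  | succ k ih =>
    have h := ih.mul hf
    rw [← pow_succ, ← pow_succ] at h
    convert h using 1 <;> push_cast <;> ring

theorem inv_add_mul_X {a b : ℚ} (ha : a ≠ 0) :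
    IsExpJet (C a + C b * X)⁻¹ a⁻¹ (-(b / a)) ((b / a) ^ 2) (-2 * (b / a) ^ 3) := by
  have h : (C a + C b * X) * (C a + C b * X)⁻¹ = 1 :=
    PowerSeries.mul_inv_cancel _ (by simpa using ha)
  set g := (C a + C b * X)⁻¹
  have hs (i : ℕ) : a * coeff (i + 1) g + b * coeff i g = 0 := by
    have := congrArg (coeff (i + 1)) h
    rw [add_mul, mul_assoc, map_add, coeff_C_mul, coeff_C_mul, coeff_succ_X_mul] at this
    simpa [coeff_one] using this
  have h0 : coeff 0 g = a⁻¹ := by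
    have := congrArg (coeff 0) h
    rw [add_mul, mul_assoc, map_add, coeff_C_mul, coeff_C_mul, coeff_zero_X_mul] at this
    exact eq_inv_of_mul_eq_one_right (by simpa using this)
  have hs' (i : ℕ) : coeff (i + 1) g = -(b / a) * coeff i g := by
    field_simp
    linear_combination hs i
  have h1 := hs' 0
  have h2 := hs' 1
  have h3 := hs' 2
  norm_num only at h1 h2 h3
  rw [h0] at h1
  rw [h1] at h2
  rw [h2] at h3
  refine ⟨h0, ?_, ?_, ?_⟩
  · rw [h1]; ring
  · rw [h2]; ring
  · rw [h3]; ring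

end IsExpJet

section Perturbation

open PowerSeries

/-- `1 / ((1 + ε X) ⋯ (k + ε X))`, the perturbed reciprocal factorial. -/
noncomputable def invFactorialSeries (ε : ℚ) (k : ℕ) : ℚ⟦X⟧ :=
  ∏ j ∈ Finset.range k, (C ((j : ℚ) + 1) + C ε * X)⁻¹

theorem invFactorialSeries_succ (ε : ℚ) (k : ℕ) :
    ((k : ℚ⟦X⟧) + 1 + C ε * X) * invFactorialSeries ε (k + 1) = invFactorialSeries ε k := by
  have h : (C ((k : ℚ) + 1) + C ε * X) * (C ((k : ℚ) + 1) + C ε * X)⁻¹ = 1 :=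
    PowerSeries.mul_inv_cancel _ (by simp; positivity)
  have hC : (C ((k : ℚ) + 1) : ℚ⟦X⟧) = (k : ℚ⟦X⟧) + 1 := by simp
  rw [invFactorialSeries, Finset.prod_range_succ, ← invFactorialSeries, ← hC]
  linear_combination invFactorialSeries ε k * h

theorem isExpJet_invFactorialSeries (ε : ℚ) (k : ℕ) :
    IsExpJet (invFactorialSeries ε k) (k.factorial : ℚ)⁻¹ (-ε * harmonic k)
      (ε ^ 2 * genHarmonic 2 k) (-2 * ε ^ 3 * genHarmonic 3 k) := by
  induction k with
  | zero => simpa [invFactorialSeries, genHarmonic] using IsExpJet.one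
  | succ k ih =>
    have h := ih.mul (IsExpJet.inv_add_mul_X (a := (k : ℚ) + 1) (b := ε) (by positivity))
    rw [invFactorialSeries, ← Finset.prod_range_succ, ← invFactorialSeries] at h
    convert h using 1
    · rw [Nat.factorial_succ]; push_cast; rw [mul_inv, mul_comm]
    · rw [harmonic_succ]; push_cast; ring
    · rw [genHarmonic, Finset.sum_range_succ, ← genHarmonic]; simp only [div_pow]; ring
    · rw [genHarmonic, Finset.sum_range_succ, ← genHarmonic]; simp only [div_pow]; ring

/-- The summand `C(n,k)⁴ k! / n!⁴` with `k` replaced by `k + X`, and zero for `k > n`. -/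
noncomputable def summandSeries (n k : ℕ) : ℚ⟦X⟧ :=
  if k ≤ n then invFactorialSeries 1 k ^ 3 * invFactorialSeries (-1) (n - k) ^ 4 else 0

theorem isExpJet_summandSeries {n k : ℕ} (h : k ≤ n) :
    IsExpJet (summandSeries n k) ((n.choose k : ℚ) ^ 4 * k.factorial / (n.factorial : ℚ) ^ 4)
      (r1 n k) (r2 n k) (r3 n k) := by
  have hj := ((isExpJet_invFactorialSeries 1 k).pow 3).mul
    ((isExpJet_invFactorialSeries (-1) (n - k)).pow 4)
  rw [summandSeries, if_pos h]
  convert hj using 1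
  · rw [Nat.cast_choose ℚ h]
    field_simp
  · rw [r1]; push_cast; ring
  · rw [r2]; push_cast; ring
  · rw [r3]; push_cast; ring

theorem pseq43_eq_coeff {n N : ℕ} (h : n ≤ N) :
    pseq43 n = 6 * (n.factorial : ℚ) ^ 4 *
      coeff 3 (∑ k ∈ Finset.range (N + 1), summandSeries n k) := by
  have hsub : ∑ k ∈ Finset.range (n + 1), summandSeries n k =
      ∑ k ∈ Finset.range (N + 1), summandSeries n k := by
    refine Finset.sum_subset (Finset.range_subset_range.2 (by omega)) fun k _ hk => ?_
    rw [summandSeries, if_neg (by simpa using hk)]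
  rw [← hsub, map_sum, Finset.mul_sum, pseq43]
  refine Finset.sum_congr rfl fun k hk => ?_
  rw [(isExpJet_summandSeries (Nat.lt_succ_iff.1 (Finset.mem_range.1 hk))).coeff_three]
  field_simp

theorem X_pow_four_dvd_summandSeries_sub (n k : ℕ) :
    (X : ℚ⟦X⟧) ^ 4 ∣
      ((n : ℚ⟦X⟧) + 1 - ((k : ℚ⟦X⟧) + X)) ^ 4 * summandSeries (n + 1) k - summandSeries n k := by
  rcases lt_trichotomy k (n + 1) with h | rfl | h
  · obtain ⟨l, rfl⟩ := Nat.exists_eq_add_of_le (Nat.lt_succ_iff.1 h)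
    have hs := invFactorialSeries_succ (-1) l
    rw [summandSeries, summandSeries, if_pos (by omega), if_pos (by omega),
      show k + l + 1 - k = l + 1 by omega, Nat.add_sub_cancel_left, ← hs]
    refine Dvd.intro 0 ?_
    simp only [map_neg, map_one]
    push_cast
    ring
  · have hz : summandSeries n (n + 1) = 0 := if_neg (by omega)
    rw [hz]
    refine Dvd.intro (summandSeries (n + 1) (n + 1)) ?_
    push_cast
    ring
  · rw [summandSeries, summandSeries, if_neg (by omega), if_neg (by omega)]
    simp

theorem X_pow_four_dvd_summandSeries_succ_sub (n k : ℕ) :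
    (X : ℚ⟦X⟧) ^ 4 ∣
      ((k : ℚ⟦X⟧) + X + 1) ^ 3 * summandSeries n (k + 1) -
        ((n : ℚ⟦X⟧) - ((k : ℚ⟦X⟧) + X)) ^ 4 * summandSeries n k := by
  rcases lt_trichotomy k n with h | rfl | h
  · obtain ⟨l, rfl⟩ := Nat.exists_eq_add_of_lt h
    have hA := invFactorialSeries_succ 1 k
    have hB := invFactorialSeries_succ (-1) l
    rw [summandSeries, summandSeries, if_pos (by omega), if_pos (by omega),
      show k + l + 1 - k = l + 1 by omega, show k + l + 1 - (k + 1) = l by omega, ← hA, ← hB]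
    refine Dvd.intro 0 ?_
    simp only [map_neg, map_one]
    push_cast
    ring
  · rw [summandSeries, if_neg (by omega)]
    refine Dvd.intro (-summandSeries k k) ?_
    ring
  · rw [summandSeries, summandSeries, if_neg (by omega), if_neg (by omega)]
    simp

end Perturbation

/-- The telescoping relation behind the recurrence, for any sequences obeying the ratio rules of
`C(n,k)⁴ k! / n!⁴`. -/
theorem sum_eq_neg_of_ratio {R : Type*} [CommRing R] (m : ℕ) (ε : R) (e : ℕ → ℕ → R)
    (hn : ∀ n k : ℕ, ((n : R) + 1 - (k + ε)) ^ 4 * e (n + 1) k = e n k)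
    (hk : ∀ n k : ℕ, ((k : R) + ε + 1) ^ 3 * e n (k + 1) = ((n : R) - (k + ε)) ^ 4 * e n k)
    (h0 : e (m + 4) (m + 5) = 0) {n : R} (hm : n = m + 2) :
    n ^ 2 * (n + 1) ^ 4 * (n + 2) ^ 4 * ((n + 2) ^ 2 *
        (729 * n ^ 4 - 162 * n ^ 3 - 171 * n ^ 2 - 4 * n + 6)) *
          ∑ k ∈ Finset.range (m + 5), e (m + 4) k -
      n ^ 2 * (n + 1) ^ 4 * (2916 * n ^ 7 + 14661 * n ^ 6 + 20862 * n ^ 5 + 947 * n ^ 4 -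
        13008 * n ^ 3 - 2370 * n ^ 2 + 1320 * n + 312) *
          ∑ k ∈ Finset.range (m + 5), e (m + 3) k +
      n ^ 2 * (4374 * n ^ 8 - 18468 * n ^ 7 - 82674 * n ^ 6 - 85776 * n ^ 5 -
        13062 * n ^ 4 + 24204 * n ^ 3 + 13528 * n ^ 2 + 2680 * n + 168) *
          ∑ k ∈ Finset.range (m + 5), e (m + 2) k -
      (2916 * n ^ 7 + 28512 * n ^ 6 + 61848 * n ^ 5 + 37667 * n ^ 4 - 12898 * n ^ 3 -
        17463 * n ^ 2 - 2692 * n + 398) * ∑ k ∈ Finset.range (m + 5), e (m + 1) k +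
      (729 * n ^ 4 + 2754 * n ^ 3 + 3717 * n ^ 2 + 2084 * n + 398) *
          ∑ k ∈ Finset.range (m + 5), e m k =
      -(ε ^ 3 * certNum n ε * e (m + 4) 0) := by
  have hG := Finset.sum_range_sub
    (fun k : ℕ => ((k : R) + ε) ^ 3 * certNum n (k + ε) * e (m + 4) k) (m + 5)
  simp only [h0, mul_zero, zero_sub, Nat.cast_zero, zero_add] at hG
  rw [← hG]
  simp only [Finset.mul_sum]
  rw [← Finset.sum_sub_distrib, ← Finset.sum_add_distrib, ← Finset.sum_sub_distrib,
    ← Finset.sum_add_distrib]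
  refine Finset.sum_congr rfl fun k _ => ?_
  have h3 : e (m + 3) k = (n + 2 - (k + ε)) ^ 4 * e (m + 4) k := by
    rw [← hn (m + 3) k, hm]; push_cast; ring
  have h2 : e (m + 2) k = (n + 1 - (k + ε)) ^ 4 * e (m + 3) k := by
    rw [← hn (m + 2) k, hm]; push_cast; ring
  have h1 : e (m + 1) k = (n - (k + ε)) ^ 4 * e (m + 2) k := by
    rw [← hn (m + 1) k, hm]; push_cast; ring
  have h0' : e m k = (n - 1 - (k + ε)) ^ 4 * e (m + 1) k := by
    rw [← hn m k, hm]; ring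
  have hs : ((k : R) + ε + 1) ^ 3 * e (m + 4) (k + 1) =
      (n + 2 - (k + ε)) ^ 4 * e (m + 4) k := by
    rw [hk (m + 4) k, hm]; push_cast; ring
  have hc := certNum_gosper n ((k : R) + ε)
  have key : ∀ a b c d f y z u v p p' s s' t t' : R,
      a - b * y + c * (y * z) - d * (y * z * u) + f * (y * z * u * v) = y * s' - p * s →
      p' * t' = y * t →
      a * t - b * (y * t) + c * (z * (y * t)) - d * (u * (z * (y * t))) +
        f * (v * (u * (z * (y * t)))) = p' * s' * t' - p * s * t := by
    intro a b c d f y z u v p p' s s' t t' h h'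
    linear_combination t * h - s' * h'
  rw [show ((k + 1 : ℕ) : R) + ε = k + ε + 1 by push_cast; ring, h0', h1, h2, h3]
  exact key _ _ _ _ _ _ _ _ _ _ _ _ _ _ _ hc hs
open PowerSeries in
theorem sum_coeff_three_summandSeries (m : ℕ) {n : ℚ} (hm : n = m + 2) :
    n ^ 2 * (n + 1) ^ 4 * (n + 2) ^ 4 * ((n + 2) ^ 2 *
        (729 * n ^ 4 - 162 * n ^ 3 - 171 * n ^ 2 - 4 * n + 6)) *
          coeff 3 (∑ k ∈ Finset.range (m + 5), summandSeries (m + 4) k) -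
      n ^ 2 * (n + 1) ^ 4 * (2916 * n ^ 7 + 14661 * n ^ 6 + 20862 * n ^ 5 + 947 * n ^ 4 -
        13008 * n ^ 3 - 2370 * n ^ 2 + 1320 * n + 312) *
          coeff 3 (∑ k ∈ Finset.range (m + 5), summandSeries (m + 3) k) +
      n ^ 2 * (4374 * n ^ 8 - 18468 * n ^ 7 - 82674 * n ^ 6 - 85776 * n ^ 5 -
        13062 * n ^ 4 + 24204 * n ^ 3 + 13528 * n ^ 2 + 2680 * n + 168) *
          coeff 3 (∑ k ∈ Finset.range (m + 5), summandSeries (m + 2) k) -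
      (2916 * n ^ 7 + 28512 * n ^ 6 + 61848 * n ^ 5 + 37667 * n ^ 4 - 12898 * n ^ 3 -
        17463 * n ^ 2 - 2692 * n + 398) *
          coeff 3 (∑ k ∈ Finset.range (m + 5), summandSeries (m + 1) k) +
      (729 * n ^ 4 + 2754 * n ^ 3 + 3717 * n ^ 2 + 2084 * n + 398) *
          coeff 3 (∑ k ∈ Finset.range (m + 5), summandSeries m k) =
      -(certNum n 0 / ((m + 4).factorial : ℚ) ^ 4) := by
  let π : ℚ⟦X⟧ →+* ℚ⟦X⟧ ⧸ Ideal.span {(X : ℚ⟦X⟧) ^ 4} := Ideal.Quotient.mk _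
  have hπ (f g : ℚ⟦X⟧) : π f = π g ↔ X ^ 4 ∣ f - g := by
    rw [Ideal.Quotient.eq, Ideal.mem_span_singleton]
  have key := sum_eq_neg_of_ratio m (π X) (fun n k => π (summandSeries n k)) (n := π (C n))
    (fun n k => by
      have := (hπ _ _).2 (X_pow_four_dvd_summandSeries_sub n k)
      simpa only [map_mul, map_pow, map_sub, map_add, map_one, map_natCast] using this)
    (fun n k => by
      have := (hπ _ _).2 (X_pow_four_dvd_summandSeries_succ_sub n k)
      simpa only [map_mul, map_pow, map_sub, map_add, map_one, map_natCast] using this)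
    (by
      have hz : summandSeries (m + 4) (m + 5) = 0 := if_neg (by omega)
      rw [hz, map_zero])
    (by rw [hm]; simp only [map_add, map_natCast, map_ofNat])
  simp only [← map_certNum, ← map_sum, ← map_mul, ← map_pow, ← map_neg, ← map_add, ← map_sub,
    ← map_one π, ← map_ofNat π, ← map_one (C (R := ℚ)), ← map_ofNat (C (R := ℚ))] at key
  have h3 := X_pow_dvd_iff.1 ((hπ _ _).1 key) 3 (by norm_num)
  have hc : constantCoeff (certNum (C n) (X : ℚ⟦X⟧)) = certNum n 0 := by
    rw [map_certNum, constantCoeff_C, constantCoeff_X]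
  have hs : constantCoeff (summandSeries (m + 4) 0) = 1 / ((m + 4).factorial : ℚ) ^ 4 := by
    simpa using (isExpJet_summandSeries (Nat.zero_le (m + 4))).coeff_zero
  have hr : coeff 3 (X ^ 3 * certNum (C n) (X : ℚ⟦X⟧) * summandSeries (m + 4) 0) =
      certNum n 0 / ((m + 4).factorial : ℚ) ^ 4 := by
    rw [mul_assoc, coeff_X_pow_mul', if_pos le_rfl, Nat.sub_self, coeff_zero_eq_constantCoeff_apply,
      map_mul, hc, hs, mul_one_div]
  rw [map_sub, sub_eq_zero] at h3
  simp only [map_add, map_sub, map_neg, hr] at h3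
  simpa only [← map_add (C (R := ℚ)), ← map_sub (C (R := ℚ)), coeff_C_mul] using h3

theorem stmt_13 :
    ∀ n : ℕ, 2 ≤ n →
      ((n : ℚ) + 2) ^ 2 *
          (729 * (n : ℚ) ^ 4 - 162 * (n : ℚ) ^ 3 - 171 * (n : ℚ) ^ 2 - 4 * (n : ℚ) + 6) *
          pseq43 (n + 2) =
        (2916 * (n : ℚ) ^ 7 + 14661 * (n : ℚ) ^ 6 + 20862 * (n : ℚ) ^ 5 + 947 * (n : ℚ) ^ 4 -
            13008 * (n : ℚ) ^ 3 - 2370 * (n : ℚ) ^ 2 + 1320 * (n : ℚ) + 312) * pseq43 (n + 1) -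
          (4374 * (n : ℚ) ^ 8 - 18468 * (n : ℚ) ^ 7 - 82674 * (n : ℚ) ^ 6 - 85776 * (n : ℚ) ^ 5 -
            13062 * (n : ℚ) ^ 4 + 24204 * (n : ℚ) ^ 3 + 13528 * (n : ℚ) ^ 2 + 2680 * (n : ℚ) +
            168) * pseq43 n +
          (n : ℚ) ^ 2 *
            (2916 * (n : ℚ) ^ 7 + 28512 * (n : ℚ) ^ 6 + 61848 * (n : ℚ) ^ 5 +
              37667 * (n : ℚ) ^ 4 - 12898 * (n : ℚ) ^ 3 - 17463 * (n : ℚ) ^ 2 -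
              2692 * (n : ℚ) + 398) * pseq43 (n - 1) -
          (n : ℚ) ^ 2 * ((n : ℚ) - 1) ^ 4 *
            (729 * (n : ℚ) ^ 4 + 2754 * (n : ℚ) ^ 3 + 3717 * (n : ℚ) ^ 2 + 2084 * (n : ℚ) +
              398) * pseq43 (n - 2) -
          6 * (729 * (n : ℚ) ^ 10 + 2754 * (n : ℚ) ^ 9 - 17424 * (n : ℚ) ^ 8 -
              179680 * (n : ℚ) ^ 7 - 490669 * (n : ℚ) ^ 6 - 549106 * (n : ℚ) ^ 5 -
              194460 * (n : ℚ) ^ 4 + 100424 * (n : ℚ) ^ 3 + 105332 * (n : ℚ) ^ 2 +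
              30840 * (n : ℚ) + 3184) /
            ((n : ℚ) * ((n : ℚ) + 1) ^ 2 * ((n : ℚ) + 2)) := by
  intro n hn
  obtain ⟨m, rfl⟩ := Nat.exists_eq_add_of_le' hn
  have key := sum_coeff_three_summandSeries m (n := ((m + 2 : ℕ) : ℚ)) (by push_cast; ring)
  rw [pseq43_eq_coeff (n := m + 2 + 2) (N := m + 4) le_rfl,
    pseq43_eq_coeff (n := m + 2 + 1) (N := m + 4) (by omega),
    pseq43_eq_coeff (n := m + 2) (N := m + 4) (by omega),
    pseq43_eq_coeff (n := m + 2 - 1) (N := m + 4) (by omega),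
    pseq43_eq_coeff (n := m + 2 - 2) (N := m + 4) (by omega)]
  have hν : ((m + 2 : ℕ) : ℚ) ≠ 0 := by positivity
  have hν1 : ((m + 2 : ℕ) : ℚ) + 1 ≠ 0 := by positivity
  have hν2 : ((m + 2 : ℕ) : ℚ) + 2 ≠ 0 := by positivity
  have hf : ((m + 2).factorial : ℚ) ≠ 0 := by positivity
  have f1 : ((m + 1).factorial : ℚ) = (((m + 2 : ℕ) : ℚ) - 1) * m.factorial := by
    rw [Nat.factorial_succ]; push_cast; ring
  have f2 : ((m + 2).factorial : ℚ) = ((m + 2 : ℕ) : ℚ) * (m + 1).factorial := by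
    rw [Nat.factorial_succ]; push_cast; ring
  have f3 : ((m + 3).factorial : ℚ) = (((m + 2 : ℕ) : ℚ) + 1) * (m + 2).factorial := by
    rw [Nat.factorial_succ]; push_cast; ring
  have f4 : ((m + 4).factorial : ℚ) = (((m + 2 : ℕ) : ℚ) + 2) * (m + 3).factorial := by
    rw [Nat.factorial_succ]; push_cast; ring
  rw [f1] at f2
  rw [f2] at f3 hf
  rw [f3] at f4
  simp only [show m + 2 + 2 = m + 4 from rfl, show m + 2 + 1 = m + 3 from rfl,
    show m + 2 - 1 = m + 1 from rfl, show m + 2 - 2 = m from rfl, show m + 4 + 1 = m + 5 from rfl]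
  rw [f4] at key
  rw [f1, f2, f3, f4]
  generalize PowerSeries.coeff 3 (∑ k ∈ Finset.range (m + 5), summandSeries (m + 4) k) = q₄ at *
  generalize PowerSeries.coeff 3 (∑ k ∈ Finset.range (m + 5), summandSeries (m + 3) k) = q₃ at *
  generalize PowerSeries.coeff 3 (∑ k ∈ Finset.range (m + 5), summandSeries (m + 2) k) = q₂ at *
  generalize PowerSeries.coeff 3 (∑ k ∈ Finset.range (m + 5), summandSeries (m + 1) k) = q₁ at *
  generalize PowerSeries.coeff 3 (∑ k ∈ Finset.range (m + 5), summandSeries m k) = q₀ at *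
  clear f1 f2 f3 f4
  generalize (m.factorial : ℚ) = g at *
  generalize ((m + 2 : ℕ) : ℚ) = ν at *
  have hg : g ≠ 0 := right_ne_zero_of_mul (right_ne_zero_of_mul hf)
  have hν' : ν - 1 ≠ 0 := left_ne_zero_of_mul (right_ne_zero_of_mul hf)
  have hcert : 6 * ν ^ 2 * (ν - 1) ^ 4 * g ^ 4 *
      (certNum ν 0 / ((ν + 2) * ((ν + 1) * (ν * ((ν - 1) * g)))) ^ 4) =
      6 * (729 * ν ^ 10 + 2754 * ν ^ 9 - 17424 * ν ^ 8 - 179680 * ν ^ 7 - 490669 * ν ^ 6 -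
        549106 * ν ^ 5 - 194460 * ν ^ 4 + 100424 * ν ^ 3 + 105332 * ν ^ 2 + 30840 * ν + 3184) /
          (ν * (ν + 1) ^ 2 * (ν + 2)) := by
    rw [certNum]
    field_simp
    ring
  rw [← hcert]
  generalize certNum ν 0 / _ = w at *
  linear_combination 6 * ν ^ 2 * (ν - 1) ^ 4 * g ^ 4 * key
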